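/- arXiv:1806.03479 — 4 statements merged into one kernel-verified Lean document; each statement's English description precedes it below -/
import Mathlib

section
/- Consider the LFT-parameterized matrix pair (A(S), B(S)) defined for S ∈ ℝ^k by A(S) = A_xx + A_xv·P(S)·(I − A_zv·P(S))⁻¹·A_zx and B(S) = B_xu + A_xv·P(S)·(I − A_zv·P(S))⁻¹·B_zu, on the well-posed set W = {S ∈ ℝ^k : I − A_zv·P(S) is invertible}. If there exists S₀ ∈ W such that the pair (A(S₀), B(S₀)) is controllable, then the set {S ∈ W : (A(S), B(S)) is not controllable} has Lebesgue measure zero in ℝ^k. In other words, controllability of the LFT-parameterized system is a generic property (Proposition: genericity of controllability). -/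
open Matrix MeasureTheory

/-- Structured parametrization: the `Mv × Mz` real matrix whose `(r i, c i)` entry is `S i`
and whose remaining entries are zero. -/
noncomputable def structP {Mv Mz k : ℕ} (r : Fin k → Fin Mv) (c : Fin k → Fin Mz)
    (S : Fin k → ℝ) : Matrix (Fin Mv) (Fin Mz) ℝ :=
  Matrix.of fun a b => ∑ i, if r i = a ∧ c i = b then S i else 0

/-- Kalman controllability matrix `[B, AB, …, A^{n−1}B]`. -/
noncomputable def ctrbMat {K : Type*} [CommRing K] {n q : ℕ}
    (A : Matrix (Fin n) (Fin n) K) (B : Matrix (Fin n) (Fin q) K) :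
    Matrix (Fin n) (Fin n × Fin q) K :=
  Matrix.of fun x p => (A ^ (p.1 : ℕ) * B) x p.2

/-- A polynomial function that does not vanish at some point vanishes only on a null set. -/
theorem volume_mvPolynomial_zero_set_eq_zero {ι : Type*} [Fintype ι] (p : MvPolynomial ι ℝ)
    {x₀ : ι → ℝ} (hx₀ : MvPolynomial.eval x₀ p ≠ 0) :
    volume {x : ι → ℝ | MvPolynomial.eval x p = 0} = 0 := by
  set Z : Set (ι → ℝ) := {x | MvPolynomial.eval x p = 0}
  have hZ : MeasurableSet Z :=
    (isClosed_eq (MvPolynomial.continuous_eval p) continuous_const).measurableSet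
  have line (v : ι → ℝ) : ∀ᵐ t : ℝ, x₀ + t • v ∉ Z := by
    set P : Polynomial ℝ := MvPolynomial.aeval (fun i => Polynomial.C (x₀ i) + Polynomial.X * Polynomial.C (v i)) p
    have hP (t : ℝ) : P.eval t = MvPolynomial.eval (x₀ + t • v) p := by
      simp only [P]
      rw [← Polynomial.coe_evalRingHom, MvPolynomial.aeval_def, MvPolynomial.hom_eval₂,
        MvPolynomial.eval, MvPolynomial.coe_eval₂Hom]
      congr 1
      · ext; simp
      · ext i; simp [mul_comm t]
    have hP0 : P ≠ 0 := by
      intro h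
      apply hx₀
      simpa [h] using (hP 0).symm
    have hfin : {t : ℝ | P.IsRoot t}.Finite := P.finite_setOfPred_isRoot hP0
    filter_upwards [measure_eq_zero_iff_ae_notMem.1 (hfin.measure_zero volume)] with t ht h
    exact ht ((hP t).trans h)
  have hmeas : MeasurableSet {y : (ι → ℝ) × ℝ | x₀ + y.2 • y.1 ∉ Z} :=
    (show Measurable fun y : (ι → ℝ) × ℝ => x₀ + y.2 • y.1 by fun_prop) hZ.compl
  have hae : ∀ᵐ t : ℝ, ∀ᵐ v : ι → ℝ, x₀ + t • v ∉ Z :=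
    (Measure.ae_ae_comm (p := fun v t => x₀ + t • v ∉ Z) hmeas).1 (ae_of_all _ line)
  obtain ⟨t, ht, ht0⟩ := (hae.and (Measure.ae_ne volume (0 : ℝ))).exists
  have hnull : volume ((fun v : ι → ℝ => t • v) ⁻¹' ((fun y => x₀ + y) ⁻¹' Z)) = 0 :=
    measure_eq_zero_iff_ae_notMem.2 ht
  rw [Measure.addHaar_preimage_smul _ ht0, measure_preimage_add, mul_eq_zero] at hnull
  refine hnull.resolve_left ?_
  simp [ht0]

section

variable {K L : Type*} [CommRing K] [CommRing L] {n q Mv Mz : ℕ}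

theorem ctrbMat_map (φ : K →+* L) (A : Matrix (Fin n) (Fin n) K)
    (B : Matrix (Fin n) (Fin q) K) :
    (ctrbMat A B).map φ = ctrbMat (A.map φ) (B.map φ) := by
  ext x j
  simp [ctrbMat, ← Matrix.map_pow, ← Matrix.map_mul]

theorem ctrbMat_smul (d : K) (A : Matrix (Fin n) (Fin n) K) (B : Matrix (Fin n) (Fin q) K) :
    ctrbMat (d • A) (d • B) =
      ctrbMat A B * diagonal fun j : Fin n × Fin q => d ^ ((j.1 : ℕ) + 1) := by
  ext x j
  simp [ctrbMat, smul_pow, pow_succ]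
  ring

theorem ctrbMat_smul_rank {F : Type*} [Field F] {d : F} (hd : d ≠ 0)
    (A : Matrix (Fin n) (Fin n) F) (B : Matrix (Fin n) (Fin q) F) :
    (ctrbMat (d • A) (d • B)).rank = (ctrbMat A B).rank := by
  rw [ctrbMat_smul]
  apply rank_mul_eq_left_of_isUnit_det
  simp [det_diagonal, Finset.prod_ne_zero_iff, hd]

/-- A real matrix has full row rank iff its Gram determinant does not vanish. -/
theorem rank_eq_iff_det_mul_transpose_ne_zero {m : Type*} [Fintype m]
    (M : Matrix (Fin n) m ℝ) : M.rank = n ↔ (M * Mᵀ).det ≠ 0 := by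
  rw [← rank_self_mul_transpose]
  constructor
  · intro h
    rw [← isUnit_iff_ne_zero, ← isUnit_iff_isUnit_det, ← linearIndependent_rows_iff_isUnit,
      linearIndependent_iff_card_eq_finrank_span, Set.finrank, ← rank_eq_finrank_span_row, h, Fintype.card_fin]
  · intro h
    rw [rank_of_isUnit _ ((isUnit_iff_isUnit_det _).2 h.isUnit), Fintype.card_fin]

/-- The linear fractional transformation `X + Y P (1 - Z P)⁻¹ T` with its denominator
`det (1 - Z P)` cleared. -/
def lftNumerator {m : ℕ} (X : Matrix (Fin n) (Fin m) K) (Y : Matrix (Fin n) (Fin Mv) K)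
    (Z : Matrix (Fin Mz) (Fin Mv) K) (T : Matrix (Fin Mz) (Fin m) K)
    (P : Matrix (Fin Mv) (Fin Mz) K) : Matrix (Fin n) (Fin m) K :=
  (1 - Z * P).det • X + Y * P * (1 - Z * P).adjugate * T

theorem lftNumerator_map {m : ℕ} (φ : K →+* L) (X : Matrix (Fin n) (Fin m) K)
    (Y : Matrix (Fin n) (Fin Mv) K) (Z : Matrix (Fin Mz) (Fin Mv) K)
    (T : Matrix (Fin Mz) (Fin m) K) (P : Matrix (Fin Mv) (Fin Mz) K) :
    (lftNumerator X Y Z T P).map φ =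
      lftNumerator (X.map φ) (Y.map φ) (Z.map φ) (T.map φ) (P.map φ) := by
  have hD : (1 - Z * P).map φ = 1 - Z.map φ * P.map φ := by
    rw [Matrix.map_sub _ (map_sub φ), Matrix.map_mul, Matrix.map_one _ (map_zero φ) (map_one φ)]
  have hdet : φ (1 - Z * P).det = (1 - Z.map φ * P.map φ).det := by
    rw [RingHom.map_det, RingHom.mapMatrix_apply, hD]
  have hadj : (1 - Z * P).adjugate.map φ = (1 - Z.map φ * P.map φ).adjugate := by
    rw [← RingHom.mapMatrix_apply, RingHom.map_adjugate, RingHom.mapMatrix_apply, hD]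
  have hsmul : ((1 - Z * P).det • X).map φ = (1 - Z.map φ * P.map φ).det • X.map φ := by
    ext; simp [← hdet]
  simp only [lftNumerator]
  rw [Matrix.map_add _ (map_add φ), hsmul, Matrix.map_mul, Matrix.map_mul, Matrix.map_mul, hadj]

theorem lftNumerator_eq_smul {F : Type*} [Field F] {m : ℕ} (X : Matrix (Fin n) (Fin m) F)
    (Y : Matrix (Fin n) (Fin Mv) F) (Z : Matrix (Fin Mz) (Fin Mv) F)
    (T : Matrix (Fin Mz) (Fin m) F) (P : Matrix (Fin Mv) (Fin Mz) F)
    (h : (1 - Z * P).det ≠ 0) :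
    lftNumerator X Y Z T P = (1 - Z * P).det • (X + Y * P * (1 - Z * P)⁻¹ * T) := by
  simp [lftNumerator, Matrix.inv_def, smul_smul, h]

end

/-- Genericity of controllability for the LFT-parameterized pair `(A(S), B(S))`:
if some well-posed `S₀` yields a controllable pair, then the set of well-posed parameters
yielding an uncontrollable pair has Lebesgue measure zero. -/
theorem structural_controllability_generic {n q Mv Mz k : ℕ}
    (Axx : Matrix (Fin n) (Fin n) ℝ) (Bxu : Matrix (Fin n) (Fin q) ℝ)
    (Axv : Matrix (Fin n) (Fin Mv) ℝ) (Azx : Matrix (Fin Mz) (Fin n) ℝ)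
    (Azv : Matrix (Fin Mz) (Fin Mv) ℝ) (Bzu : Matrix (Fin Mz) (Fin q) ℝ)
    (r : Fin k → Fin Mv) (c : Fin k → Fin Mz)
    (hinj : Function.Injective fun i => (r i, c i))
    (W : Set (Fin k → ℝ))
    (hW : W = {S | IsUnit (1 - Azv * structP r c S)})
    (A : (Fin k → ℝ) → Matrix (Fin n) (Fin n) ℝ)
    (B : (Fin k → ℝ) → Matrix (Fin n) (Fin q) ℝ)
    (hA : ∀ S, A S = Axx + Axv * structP r c S * (1 - Azv * structP r c S)⁻¹ * Azx)
    (hB : ∀ S, B S = Bxu + Axv * structP r c S * (1 - Azv * structP r c S)⁻¹ * Bzu)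
    (hctrl : ∃ S₀ ∈ W, (ctrbMat (A S₀) (B S₀)).rank = n) :
    volume {S : Fin k → ℝ | S ∈ W ∧ (ctrbMat (A S) (B S)).rank ≠ n} = 0 := by
  subst hW
  let κ : ℝ →+* MvPolynomial (Fin k) ℝ := MvPolynomial.C
  let P : Matrix (Fin Mv) (Fin Mz) (MvPolynomial (Fin k) ℝ) :=
    of fun a b => ∑ i, if r i = a ∧ c i = b then MvPolynomial.X i else 0
  let G : Matrix (Fin n) (Fin n × Fin q) (MvPolynomial (Fin k) ℝ) :=
    ctrbMat (lftNumerator (Axx.map κ) (Axv.map κ) (Azv.map κ) (Azx.map κ) P)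
      (lftNumerator (Bxu.map κ) (Axv.map κ) (Azv.map κ) (Bzu.map κ) P)
  have hP (S : Fin k → ℝ) : P.map (MvPolynomial.eval S) = structP r c S := by
    ext a b
    simp [P, structP, apply_ite (MvPolynomial.eval S)]
  have hκ {a b : ℕ} (S : Fin k → ℝ) (M : Matrix (Fin a) (Fin b) ℝ) :
      (M.map κ).map (MvPolynomial.eval S) = M := by
    ext; simp [κ]
  have hG (S : Fin k → ℝ) : G.map (MvPolynomial.eval S) =
      ctrbMat (lftNumerator Axx Axv Azv Azx (structP r c S))
        (lftNumerator Bxu Axv Azv Bzu (structP r c S)) := by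
    simp only [G, ctrbMat_map, lftNumerator_map, hκ, hP]
  have key (S : Fin k → ℝ) (hS : IsUnit (1 - Azv * structP r c S)) :
      (ctrbMat (A S) (B S)).rank = n ↔ MvPolynomial.eval S (G * Gᵀ).det ≠ 0 := by
    have hd : (1 - Azv * structP r c S).det ≠ 0 := ((isUnit_iff_isUnit_det _).1 hS).ne_zero
    rw [RingHom.map_det, RingHom.mapMatrix_apply, Matrix.map_mul, transpose_map,
      ← rank_eq_iff_det_mul_transpose_ne_zero, hG, lftNumerator_eq_smul _ _ _ _ _ hd,
      lftNumerator_eq_smul _ _ _ _ _ hd, ctrbMat_smul_rank hd, hA, hB]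
  obtain ⟨S₀, hS₀, hrank⟩ := hctrl
  refine measure_mono_null ?_
    (volume_mvPolynomial_zero_set_eq_zero (G * Gᵀ).det ((key S₀ hS₀).1 hrank))
  rintro S ⟨hS, hne⟩
  exact not_not.1 fun h => hne ((key S hS).2 h)
end

section
/- Let V be a finite vertex set with |V| = p ≥ 2 and let r : V → V → Prop be the edge relation of a directed graph on V. Suppose σ and τ are two distinct permutations of V, each consisting of a single p-cycle (i.e., each is a Hamiltonian cycle of the digraph), such that r(v, σ(v)) and r(v, τ(v)) hold for every v ∈ V. Then for every vertex v₀ (i.e., for every edge (v₀, σ(v₀)) of the first Hamiltonian cycle) there exists a directed cycle of the digraph of length m with 2 ≤ m ≤ p − 1 that contains the edge (v₀, σ(v₀)): explicitly, there exist m with 2 ≤ m ≤ p−1 and an injective map f : ℤ/mℤ → V with f(0) = v₀, f(1) = σ(v₀), and r(f(t), f(t+1)) for all t ∈ ℤ/mℤ. (Lemma: if a digraph on p vertices has two distinct Hamiltonian cycles, every edge of one of them lies on a cycle of length at most p−1.) -/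
/-- A permutation that is a single cycle moving every point is a cycle on the whole type. -/
theorem Equiv.Perm.IsCycle.isCycleOn_univ_of_support_eq {V : Type*} [Fintype V] [DecidableEq V]
    {σ : Equiv.Perm V} (hσ : σ.IsCycle) (hsupp : σ.support = Finset.univ) :
    σ.IsCycleOn ((Finset.univ : Finset V) : Set V) := by
  have h := hσ.isCycleOn
  rw [← hsupp]
  convert h using 1
  ext x
  simp

/-- A chord `(σ ^ a) v → (σ ^ b) v` that jumps forward along a Hamiltonian cycle `σ`, without
skipping the edge `v → σ v`, yields a shorter directed cycle through that edge. -/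
theorem exists_short_cycle_of_chord {V : Type*} [Fintype V] {r : V → V → Prop}
    {σ : Equiv.Perm V} (hσ : σ.IsCycleOn ((Finset.univ : Finset V) : Set V))
    (hrσ : ∀ v, r v (σ v)) (v : V) {a b : ℕ} (ha : 1 ≤ a) (hab : a + 1 < b)
    (hb : b ≤ Fintype.card V) (hchord : r ((σ ^ a) v) ((σ ^ b) v)) :
    ∃ m : ℕ, 2 ≤ m ∧ m ≤ Fintype.card V - 1 ∧
      ∃ f : ZMod m → V, Function.Injective f ∧ f 0 = v ∧ f 1 = σ v ∧
        ∀ t : ZMod m, r (f t) (f (t + 1)) := by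
  obtain ⟨d, rfl⟩ : ∃ d, b = a + 1 + d := ⟨b - (a + 1), by omega⟩
  obtain ⟨m, hm⟩ : ∃ m, Fintype.card V = m + d := ⟨Fintype.card V - d, by omega⟩
  have hm2 : 2 ≤ m := by omega
  have : Fact (1 < m) := ⟨hm2⟩
  have : NeZero m := ⟨by omega⟩
  have hperiod : (σ ^ (m + d)) v = v :=
    (hσ.pow_apply_eq (Finset.mem_univ v)).2 (by rw [Finset.card_univ, hm])
  have hstep : ∀ n, r ((σ ^ n) v) ((σ ^ (n + 1)) v) := fun n => by
    rw [pow_succ', Equiv.Perm.mul_apply]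
    exact hrσ _
  refine ⟨m, hm2, by omega,
    fun t => (σ ^ (if t.val ≤ a then t.val else t.val + d)) v, ?_, ?_, ?_, ?_⟩
  · intro s t hst
    have hs := ZMod.val_lt s
    have ht := ZMod.val_lt t
    have h := (hσ.pow_apply_eq_pow_apply (Finset.mem_univ v)).1 hst
    rw [Finset.card_univ, hm] at h
    have h' := h.eq_of_lt_of_lt (by split_ifs <;> omega) (by split_ifs <;> omega)
    apply ZMod.val_injective m
    split_ifs at h' <;> omega
  · simp
  · simp [ZMod.val_one, ha]
  · intro t
    have ht := ZMod.val_lt t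
    have hval : (t + 1).val = if t.val + 1 = m then 0 else t.val + 1 := by
      rw [ZMod.val_add, ZMod.val_one]
      split_ifs with h
      · rw [h, Nat.mod_self]
      · exact Nat.mod_eq_of_lt (by omega)
    simp only [hval]
    by_cases hlast : t.val + 1 = m
    · simp only [hlast, if_true, Nat.zero_le, pow_zero, Equiv.Perm.one_apply]
      split_ifs with hta
      · have hat : t.val = a := by omega
        have hmd : a + 1 + d = m + d := by omega
        rwa [hmd, hperiod, ← hat] at hchord
      · have h := hstep (t.val + d)
        rwa [show t.val + d + 1 = m + d by omega, hperiod] at h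
    · simp only [hlast, if_false]
      by_cases hta : t.val = a
      · simpa [hta, add_right_comm] using hchord
      · by_cases hlt : t.val ≤ a
        · rw [if_pos hlt, if_pos (by omega)]
          exact hstep _
        · rw [if_neg hlt, if_neg (by omega), add_right_comm]
          exact hstep _

/-- If a Hamiltonian cycle `τ` never jumps forward along the Hamiltonian cycle `σ`, cut open just
before `w`, then `τ = σ`. -/
theorem Equiv.Perm.IsCycleOn.eq_of_forall_chord_ne {V : Type*} [Fintype V] {σ τ : Equiv.Perm V}
    (hσ : σ.IsCycleOn ((Finset.univ : Finset V) : Set V))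
    (hτ : τ.IsCycleOn ((Finset.univ : Finset V) : Set V)) (w : V)
    (h : ∀ a b, a + 1 < b → b < Fintype.card V → τ ((σ ^ a) w) ≠ (σ ^ b) w) : τ = σ := by
  have hw := Finset.mem_univ w
  have hpow : ∀ n < Fintype.card V, (τ ^ n) w = (σ ^ n) w := by
    intro n
    induction n using Nat.strong_induction_on with
    | _ n ih =>
      intro hn
      cases n with
      | zero => rfl
      | succ n =>
        obtain ⟨b, hb, hbw⟩ := hσ.exists_pow_eq hw (Finset.mem_univ ((τ ^ (n + 1)) w))
        rw [Finset.card_univ] at hb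
        have hstep : τ ((σ ^ n) w) = (σ ^ b) w := by
          rw [← ih n n.lt_succ_self (by omega), hbw, pow_succ', Equiv.Perm.mul_apply]
        rcases lt_trichotomy b (n + 1) with hlt | rfl | hgt
        · rw [← ih b hlt hb] at hbw
          have hmod := (hτ.pow_apply_eq_pow_apply hw).1 hbw
          rw [Finset.card_univ] at hmod
          exact absurd (hmod.eq_of_lt_of_lt hb hn) hlt.ne
        · exact hbw.symm
        · exact absurd hstep (h n b hgt hb)
  ext v
  obtain ⟨n, hn, rfl⟩ := hσ.exists_pow_eq hw (Finset.mem_univ v)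
  rw [Finset.card_univ] at hn
  have hsucc : (τ ^ (n + 1)) w = (σ ^ (n + 1)) w := by
    rcases (Nat.succ_le_of_lt hn).lt_or_eq with hlt | heq
    · exact hpow _ hlt
    · rw [(hτ.pow_apply_eq hw).2 (by rw [Finset.card_univ, ← heq]),
        (hσ.pow_apply_eq hw).2 (by rw [Finset.card_univ, ← heq])]
  rwa [pow_succ', pow_succ', Equiv.Perm.mul_apply, Equiv.Perm.mul_apply, hpow n hn] at hsucc

/-- If a digraph on `p ≥ 2` vertices has two distinct Hamiltonian cycles (given as two distinct
cyclic permutations of the whole vertex set whose successor edges all lie in the digraph),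
then every edge `(v₀, σ(v₀))` of the first Hamiltonian cycle lies on a directed cycle of
length `m` with `2 ≤ m ≤ p − 1`. -/
theorem edge_on_short_cycle_of_two_hamiltonian_cycles {V : Type*} [Fintype V] [DecidableEq V]
    {p : ℕ} (hp : 2 ≤ p) (hV : Fintype.card V = p)
    (r : V → V → Prop)
    (σ τ : Equiv.Perm V) (hστ : σ ≠ τ)
    (hσcyc : σ.IsCycle) (hσsupp : σ.support = Finset.univ)
    (hτcyc : τ.IsCycle) (hτsupp : τ.support = Finset.univ)
    (hrσ : ∀ v, r v (σ v)) (hrτ : ∀ v, r v (τ v)) :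
    ∀ v₀ : V, ∃ m : ℕ, 2 ≤ m ∧ m ≤ p - 1 ∧
      ∃ f : ZMod m → V, Function.Injective f ∧ f 0 = v₀ ∧ f 1 = σ v₀ ∧
        ∀ t : ZMod m, r (f t) (f (t + 1)) := by
  intro v₀
  subst hV
  have hσ := hσcyc.isCycleOn_univ_of_support_eq hσsupp
  have hτ := hτcyc.isCycleOn_univ_of_support_eq hτsupp
  by_contra hno
  refine hστ (hσ.eq_of_forall_chord_ne hτ (σ v₀) fun a b hab hb heq => hno ?_).symm
  refine exists_short_cycle_of_chord hσ hrσ v₀ (a := a + 1) (b := b + 1)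
    (by omega) (by omega) (by omega) ?_
  rw [pow_succ, pow_succ, Equiv.Perm.mul_apply, Equiv.Perm.mul_apply, ← heq]
  exact hrτ _
end

section
/- Let G be a k×k matrix with entries in the field ℝ(λ) of real rational functions. Consider the digraph on vertices {1,…,k} with an edge from i to j if and only if G_{ji} ≠ 0 (self-loops allowed), and call an edge (i,j) a λ-edge if G_{ji} is not a constant, i.e., G_{ji} does not lie in the image of ℝ in ℝ(λ). If no directed cycle of this digraph contains a λ-edge, then every coefficient of the determinant det(G·diag(X₁,…,X_k) − I), regarded as a multivariate polynomial in the indeterminates X₁,…,X_k with coefficients in ℝ(λ), lies in ℝ (i.e., the determinant is independent of λ). (Necessity direction of the paper's Lemma relating λ-cycles to parameter-dependent zeros.) -/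
open Matrix

/-- The orbit of `i` under a permutation of a finite type, as an injective cyclic sequence
starting at `i`. -/
theorem Equiv.Perm.exists_zmod_orbit {α : Type*} [Finite α] (σ : Equiv.Perm α) (i : α) :
    ∃ m : ℕ, 0 < m ∧ ∃ f : ZMod m → α, Function.Injective f ∧ f 0 = i ∧
      (∀ t, f (t + 1) = σ (f t)) ∧ ∀ t, ∃ n : ℕ, f t = σ^[n] i := by
  have hpos : 0 < Function.minimalPeriod σ i :=
    Function.minimalPeriod_pos_of_mem_periodicPts (σ.injective.mem_periodicPts i)
  have : NeZero (Function.minimalPeriod σ i) := ⟨hpos.ne'⟩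
  refine ⟨Function.minimalPeriod σ i, hpos, fun t => σ^[t.val] i, ?_, by simp, ?_,
    fun t => ⟨_, rfl⟩⟩
  · intro s t hst
    exact ZMod.val_injective _ (Function.iterate_injOn_Iio_minimalPeriod
      (ZMod.val_lt s) (ZMod.val_lt t) hst)
  · intro t
    simp only [ZMod.val_add, ZMod.val_one_eq_one_mod, Nat.add_mod_mod,
      Function.iterate_mod_minimalPeriod_eq, Function.iterate_succ_apply']

/-- Necessity direction of the λ-cycle lemma: if no directed cycle of the digraph associated
with `G ∈ ℝ(λ)^{k×k}` contains a λ-edge (a nonconstant entry), then every coefficient of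
`det(G·diag(X₁,…,X_k) − I)`, as a multivariate polynomial in `X₁,…,X_k` over `ℝ(λ)`,
is a constant (lies in the image of `ℝ` in `ℝ(λ)`). -/
theorem det_coeff_constant_of_no_lambda_cycle {k : ℕ}
    (G : Matrix (Fin k) (Fin k) (RatFunc ℝ))
    (hnocycle : ∀ (m : ℕ), 0 < m → ∀ f : ZMod m → Fin k, Function.Injective f →
      (∀ t, G (f (t + 1)) (f t) ≠ 0) →
      ∀ t, G (f (t + 1)) (f t) ∈ Set.range (fun x : ℝ => RatFunc.C x)) :
    ∀ d : Fin k →₀ ℕ,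
      MvPolynomial.coeff d
        ((G.map (fun x => (MvPolynomial.C x : MvPolynomial (Fin k) (RatFunc ℝ))) *
            Matrix.diagonal (fun i => (MvPolynomial.X i : MvPolynomial (Fin k) (RatFunc ℝ)))
          - 1).det)
        ∈ Set.range (fun x : ℝ => RatFunc.C x) := by
  set M := G.map (fun x => (MvPolynomial.C x : MvPolynomial (Fin k) (RatFunc ℝ))) *
    Matrix.diagonal (fun i => (MvPolynomial.X i : MvPolynomial (Fin k) (RatFunc ℝ))) - 1 with hM
  have hentry (a b : Fin k) :
      M a b = MvPolynomial.C (G a b) * MvPolynomial.X b - if a = b then 1 else 0 := by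
    simp [hM, Matrix.mul_diagonal, Matrix.one_apply]
  let S : Subring (MvPolynomial (Fin k) (RatFunc ℝ)) :=
    (MvPolynomial.map (RatFunc.C : ℝ →+* RatFunc ℝ)).range
  have hentry_mem (a b : Fin k) (h : G a b ∈ Set.range (fun x : ℝ => RatFunc.C x)) :
      M a b ∈ S := by
    obtain ⟨r, hr⟩ := h
    rw [hentry]
    refine S.sub_mem (S.mul_mem ⟨MvPolynomial.C r, ?_⟩ ⟨MvPolynomial.X b, by simp⟩) ?_
    · rw [← hr]; simp
    · split_ifs
      exacts [S.one_mem, S.zero_mem]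
  have hdet : M.det ∈ S := by
    rw [Matrix.det_apply]
    refine S.sum_mem fun σ _ => ?_
    rw [Units.smul_def]
    refine S.zsmul_mem ?_ _
    by_cases hσ : ∃ j, σ j ≠ j ∧ G (σ j) j = 0
    · obtain ⟨j, hj, hG⟩ := hσ
      rw [Finset.prod_eq_zero (Finset.mem_univ j) (by simp [hentry, hG, hj])]
      exact S.zero_mem
    · push Not at hσ
      refine S.prod_mem fun i _ => hentry_mem _ _ ?_
      by_cases hi : G (σ i) i = 0
      · exact ⟨0, by simp [hi]⟩
      obtain ⟨m, hm, f, hf, hf0, hstep, horbit⟩ := σ.exists_zmod_orbit i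
      have key := hnocycle m hm f hf (fun t => ?_) 0
      · rwa [hstep, hf0] at key
      · rw [hstep]
        by_cases hfix : σ (f t) = f t
        · obtain ⟨n, hn⟩ := horbit t
          have : f t = i := by
            rw [hn] at hfix ⊢
            rw [← Function.iterate_succ_apply' σ n i, Function.iterate_succ_apply] at hfix
            have hσi : σ i = i := σ.injective.iterate n hfix
            exact Function.iterate_fixed hσi n
          rwa [this]
        · exact hσ _ hfix
  obtain ⟨p, hp⟩ := hdet
  intro d
  rw [← hp]
  exact ⟨p.coeff d, by simp [MvPolynomial.coeff_map]⟩
end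

section
/- Let V be a finite vertex set with |V| = d + 1 for some d ≥ 1, let r : V → V → Prop be the edge relation of a directed graph, and let u, v ∈ V with u ≠ v. Suppose there are two distinct directed Hamiltonian (spanning) paths from u to v: bijections f, g : {0,1,…,d} → V with f(0) = g(0) = u, f(d) = g(d) = v, f ≠ g, and r(f(t), f(t+1)) and r(g(t), g(t+1)) for all 0 ≤ t < d. Then there exists a directed path in the digraph from u to v of length at most d − 1: some m ≤ d − 1 and an injective map h : {0,1,…,m} → V with h(0) = u, h(m) = v, and r(h(t), h(t+1)) for all 0 ≤ t < m. (Shorter-path consequence of the paper's two-Hamiltonian-cycles lemma, used in the proof of the input-reachability rank lemma.) -/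
/-- An injective self-map of `Fin n` with `σ t ≤ t` for all `t` is the identity. -/
theorem Fin.eq_self_of_injective_of_le {n : ℕ} {σ : Fin n → Fin n}
    (hσ : Function.Injective σ) (hle : ∀ t, σ t ≤ t) (t : Fin n) : σ t = t := by
  induction t using WellFoundedLT.induction with
  | ind t ih =>
    by_contra hne
    exact hne (hσ (ih (σ t) (lt_of_le_of_ne (hle t) hne)))

/-- An injective self-map of `Fin (d + 1)` fixing `0` and different from the identity
increases by at least two at some step. -/
theorem Fin.exists_add_two_le_of_injective {d : ℕ} {σ : Fin (d + 1) → Fin (d + 1)}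
    (hσ : Function.Injective σ) (h0 : σ 0 = 0) (hne : ∃ t, σ t ≠ t) :
    ∃ t : Fin d, (σ t.castSucc : ℕ) + 2 ≤ σ t.succ := by
  by_contra! hstep
  obtain ⟨t, ht⟩ := hne
  refine ht (Fin.eq_self_of_injective_of_le hσ (fun s => ?_) t)
  induction s using Fin.induction with
  | zero => exact h0.le
  | succ i ih =>
    have := hstep i
    simp only [Fin.le_def, Fin.val_castSucc, Fin.val_succ] at ih ⊢
    omega

/-- Replacing the stretch of an injective directed path between positions `a` and `b`,
where `a + 2 ≤ b`, by a single edge gives a strictly shorter injective directed path. -/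
theorem exists_shorter_path_of_chord {V : Type*} {d : ℕ} {r : V → V → Prop}
    {f : Fin (d + 1) → V} (hf : Function.Injective f)
    (hrf : ∀ t : Fin d, r (f t.castSucc) (f t.succ)) {a b : Fin (d + 1)}
    (hab : (a : ℕ) + 2 ≤ b) (hr : r (f a) (f b)) :
    ∃ m : ℕ, m ≤ d - 1 ∧ ∃ h : Fin (m + 1) → V, Function.Injective h ∧
      h 0 = f 0 ∧ h (Fin.last m) = f (Fin.last d) ∧
      ∀ t : Fin m, r (h t.castSucc) (h t.succ) := by
  obtain ⟨a, ha⟩ := a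
  obtain ⟨b, hb⟩ := b
  simp only at hab
  let k : Fin (a + 1 + (d - b) + 1) → Fin (d + 1) := fun i =>
    ⟨if (i : ℕ) ≤ a then i else i + (b - a - 1), by split_ifs <;> omega⟩
  refine ⟨a + 1 + (d - b), by omega, fun i => f (k i), hf.comp fun i j hij => ?_,
    congrArg f ?_, congrArg f ?_, fun t => ?_⟩
  · simp only [k, Fin.mk.injEq] at hij
    ext
    split_ifs at hij <;> omega
  · simp [k]
  · ext
    simp only [k, Fin.val_last]
    split_ifs <;> omega
  · by_cases hta : (t : ℕ) = a
    · have h1 : k t.castSucc = ⟨a, ha⟩ := by simp [k, hta]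
      have h2 : k t.succ = ⟨b, hb⟩ := by
        ext
        simp only [k, Fin.val_succ]
        split_ifs <;> omega
      simpa only [h1, h2] using hr
    · have hlt : (k t.castSucc : ℕ) < d := by
        simp only [k, Fin.val_castSucc]
        split_ifs <;> omega
      have h2 : k t.succ = (⟨k t.castSucc, hlt⟩ : Fin d).succ := by
        ext
        simp only [k, Fin.val_succ, Fin.val_castSucc]
        split_ifs <;> omega
      beta_reduce
      rw [h2]
      exact hrf ⟨k t.castSucc, hlt⟩

/-- If a digraph on `d + 1` vertices (`d ≥ 1`) has two distinct directed Hamiltonian paths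
from `u` to `v`, then it has a directed path from `u` to `v` of length at most `d − 1`. -/
theorem short_path_of_two_hamiltonian_paths {V : Type*} [Fintype V] {d : ℕ} (hd : 1 ≤ d)
    (hV : Fintype.card V = d + 1)
    (r : V → V → Prop) (u v : V) (huv : u ≠ v)
    (f g : Fin (d + 1) → V) (hf : Function.Bijective f) (hg : Function.Bijective g)
    (hfg : f ≠ g)
    (hf0 : f 0 = u) (hfd : f (Fin.last d) = v)
    (hg0 : g 0 = u) (hgd : g (Fin.last d) = v)
    (hrf : ∀ t : Fin d, r (f t.castSucc) (f t.succ))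
    (hrg : ∀ t : Fin d, r (g t.castSucc) (g t.succ)) :
    ∃ m : ℕ, m ≤ d - 1 ∧ ∃ h : Fin (m + 1) → V, Function.Injective h ∧
      h 0 = u ∧ h (Fin.last m) = v ∧ ∀ t : Fin m, r (h t.castSucc) (h t.succ) := by
  subst hf0 hfd
  let e := Equiv.ofBijective f hf
  have he : ∀ x, f (e.symm x) = x := e.apply_symm_apply
  obtain ⟨t, ht⟩ := Fin.exists_add_two_le_of_injective (σ := fun s => e.symm (g s))
    (e.symm.injective.comp hg.injective) (e.symm_apply_eq.2 hg0) (by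
      by_contra! hid
      exact hfg (funext fun s => by rw [← he (g s), hid s]))
  exact exists_shorter_path_of_chord hf.injective hrf ht (by simpa only [he] using hrg t)
end
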